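/- Let Ω ⊂ ℝ² be a bounded Lipschitz domain satisfying the weak John condition: ∂Ω ∩ {y = 0} = I is a nonempty interval, Ω ⊂ {(x,y) : y < 0}, and ∫_Ω e^{ay} dx dy ≤ |I|/a for every a > 0. Set ∂_SΩ = I and ∂_*Ω = ∂Ω \ I. Then σ_k^N(Ω) · L(∂_SΩ) ≤ (2k−1)π for every k ≥ 1. Moreover: (a) the bound is sharp for k = 1: for the rectangles Ω_n = I × (−n, 0) (which satisfy the standard John condition), σ_1^N(Ω_n) · |I| → π as n → ∞; (b) for k ≥ 2, if the inequality ∫_Ω e^{ay} dx dy ≤ |I|/a is strict for every a > 0, then σ_k^N(Ω) · L(∂_SΩ) < (2k−1)π. (Proposition 3.11 of the paper.) -/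

import Mathlib

open Set MeasureTheory Metric Filter Asymptotics
open scoped ENNReal Topology NNReal

noncomputable section

abbrev E2 : Type := EuclideanSpace ℝ (Fin 2)

def IsLipschitzDomain (Ω : Set E2) : Prop :=
  IsOpen Ω ∧ IsConnected Ω ∧ Bornology.IsBounded Ω ∧
    ∀ p ∈ frontier Ω, ∃ (e : E2 ≃ₗᵢ[ℝ] E2) (K : ℝ≥0) (φ : ℝ → ℝ) (U : Set E2),
      LipschitzWith K φ ∧ IsOpen U ∧ p ∈ U ∧
      ∀ x ∈ U, (x ∈ Ω ↔ φ (e x 0) < e x 1)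

def dirEnergy (Ω : Set E2) (f : E2 → ℝ) : ℝ≥0∞ :=
  ∫⁻ x in Ω, (‖fderiv ℝ f x‖₊ : ℝ≥0∞) ^ 2

def bdryInt (Γ : Set E2) (ρ f : E2 → ℝ) : ℝ≥0∞ :=
  ∫⁻ x in Γ, ENNReal.ofReal (ρ x * (f x) ^ 2) ∂μH[1]

def rayleigh (Ω Γ : Set E2) (ρ f : E2 → ℝ) : ℝ≥0∞ :=
  dirEnergy Ω f / bdryInt Γ ρ f

def steklovMixed (Ω ΓS ΓD : Set E2) (ρ : E2 → ℝ) (k : ℕ) : ℝ≥0∞ :=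
  ⨅ (V : Submodule ℝ (E2 → ℝ))
    (_ : Module.finrank ℝ V = k + 1)
    (_ : ∀ f ∈ V, ContDiff ℝ (⊤ : ℕ∞) f)
    (_ : ∀ f ∈ V, ∀ᶠ x in nhdsSet ΓD, f x = 0)
    (_ : ∀ f ∈ V, Set.EqOn f 0 (closure Ω) → f = 0),
    ⨆ f ∈ V, ⨆ (_ : ¬ Set.EqOn f 0 (closure Ω)), rayleigh Ω ΓS ρ f

def steklovN (Ω ΓS : Set E2) (k : ℕ) : ℝ≥0∞ :=
  steklovMixed Ω ΓS ∅ (fun _ => 1) k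

def steklovD (Ω ΓS ΓD : Set E2) (k : ℕ) : ℝ≥0∞ :=
  steklovMixed Ω ΓS ΓD (fun _ => 1) k

def steklovW (Ω : Set E2) (ρ : E2 → ℝ) (k : ℕ) : ℝ≥0∞ :=
  steklovMixed Ω (frontier Ω) ∅ ρ k

def steklov (Ω : Set E2) (k : ℕ) : ℝ≥0∞ := steklovW Ω (fun _ => 1) k

def IsArc (A : Set E2) : Prop :=
  ∃ γ : ℝ → E2, ContinuousOn γ (Icc 0 1) ∧ InjOn γ (Icc 0 1) ∧ A = γ '' Icc 0 1

def IsLoop (A : Set E2) : Prop :=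
  ∃ γ : ℝ → E2, ContinuousOn γ (Icc 0 1) ∧ InjOn γ (Ico 0 1) ∧ γ 0 = γ 1 ∧ A = γ '' Icc 0 1

def IsBoundaryPart (Γ : Set E2) : Prop :=
  ∃ F : Finset (Set E2), (∀ A ∈ F, IsArc A ∨ IsLoop A) ∧ Γ = ⋃₀ ↑F

structure SteklovDecomp (Ω ΓS Γstar : Set E2) : Prop where
  partS : IsBoundaryPart ΓS
  partStar : IsBoundaryPart Γstar
  union_eq : ΓS ∪ Γstar = frontier Ω
  inter_finite : (ΓS ∩ Γstar).Finite
  nonemptyS : ΓS.Nonempty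

/-- The point of the plane with coordinates `x` and `y`. -/
def planePoint (x y : ℝ) : E2 := !₂[x, y]

/-- The horizontal segment `[a, b] × {0}`. -/
def horizontalSegment (a b : ℝ) : Set E2 := {x : E2 | x 1 = 0 ∧ a ≤ x 0 ∧ x 0 ≤ b}

@[simp] lemma planePoint_apply_zero (x y : ℝ) : planePoint x y 0 = x := rfl

@[simp] lemma planePoint_apply_one (x y : ℝ) : planePoint x y 1 = y := rfl

lemma planePoint_coords (p : E2) : planePoint (p 0) (p 1) = p := by
  ext i; fin_cases i <;> rfl

lemma contDiff_planePoint {n : WithTop ℕ∞} :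
    ContDiff ℝ n (fun p : ℝ × ℝ => planePoint p.1 p.2) := by
  rw [contDiff_euclidean]
  intro i
  fin_cases i
  · exact contDiff_fst
  · exact contDiff_snd

lemma measurePreserving_planePoint :
    MeasurePreserving (fun p : ℝ × ℝ => planePoint p.1 p.2) := by
  have h := (PiLp.volume_preserving_toLp (Fin 2)).comp (volume_preserving_finTwoArrow ℝ).symm
  exact h

lemma measurableEmbedding_planePoint :
    MeasurableEmbedding (fun p : ℝ × ℝ => planePoint p.1 p.2) := by
  have h := (MeasurableEquiv.toLp 2 (Fin 2 → ℝ)).measurableEmbedding.comp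
    (MeasurableEquiv.finTwoArrow (α := ℝ)).symm.measurableEmbedding
  exact h

lemma setLIntegral_plane (s : Set E2) (g : E2 → ℝ≥0∞) :
    ∫⁻ x in s, g x =
      ∫⁻ p in {p : ℝ × ℝ | planePoint p.1 p.2 ∈ s}, g (planePoint p.1 p.2) :=
  (measurePreserving_planePoint.setLIntegral_comp_preimage_emb
    measurableEmbedding_planePoint g s).symm

lemma isometry_planePoint_zero : Isometry (fun x : ℝ => planePoint x 0) := by
  refine Isometry.of_dist_eq fun x y => ?_
  simp [EuclideanSpace.dist_eq, Real.dist_eq, Real.sqrt_sq_eq_abs]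

lemma hausdorffMeasure_restrict_horizontalSegment (a b : ℝ) :
    (μH[1] : Measure E2).restrict (horizontalSegment a b) =
      (volume.restrict (Icc a b)).map (fun x : ℝ => planePoint x 0) := by
  have hpre : (fun x : ℝ => planePoint x 0) ⁻¹' (horizontalSegment a b) = Icc a b := by
    ext x; simp [horizontalSegment]
  have hms : MeasurableSet (horizontalSegment a b) := by
    refine IsClosed.measurableSet ?_
    have h (i : Fin 2) : Continuous fun x : E2 => x i := by fun_prop
    exact (isClosed_eq (h 1) continuous_const).inter
      ((isClosed_le continuous_const (h 0)).inter (isClosed_le (h 0) continuous_const))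
  rw [← hpre, ← Measure.restrict_map isometry_planePoint_zero.continuous.measurable hms,
    ← hausdorffMeasure_real, isometry_planePoint_zero.map_hausdorffMeasure (Or.inl zero_le_one),
    Measure.restrict_restrict hms]
  congr 1
  refine (inter_eq_left.2 ?_).symm
  rintro p ⟨hp, -⟩
  exact ⟨p 0, by conv_rhs => rw [← planePoint_coords p, hp]⟩

lemma hausdorffMeasure_horizontalSegment (a b : ℝ) :
    (μH[1] : Measure E2) (horizontalSegment a b) = ENNReal.ofReal (b - a) := by
  rw [← Measure.restrict_apply_univ, hausdorffMeasure_restrict_horizontalSegment,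
    Measure.map_apply isometry_planePoint_zero.continuous.measurable MeasurableSet.univ]
  simp

lemma bdryInt_horizontalSegment {a b : ℝ} (hab : a ≤ b) {f : E2 → ℝ} (hf : Continuous f) :
    bdryInt (horizontalSegment a b) (fun _ => 1) f =
      ENNReal.ofReal (∫ x in a..b, f (planePoint x 0) ^ 2) := by
  have hc : Continuous fun x : ℝ => f (planePoint x 0) ^ 2 :=
    (hf.comp isometry_planePoint_zero.continuous).pow 2
  rw [bdryInt, hausdorffMeasure_restrict_horizontalSegment,
    isometry_planePoint_zero.isClosedEmbedding.measurableEmbedding.lintegral_map,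
    intervalIntegral.integral_of_le hab, ← integral_Icc_eq_integral_Ioc,
    ofReal_integral_eq_lintegral_ofReal hc.continuousOn.integrableOn_Icc
      (Eventually.of_forall fun x => sq_nonneg _)]
  simp

lemma nnnorm_sq_dual_plane (L : E2 →L[ℝ] ℝ) :
    (‖L‖₊ : ℝ≥0∞) ^ 2 =
      ENNReal.ofReal (L (planePoint 1 0) ^ 2 + L (planePoint 0 1) ^ 2) := by
  set v := (InnerProductSpace.toDual ℝ E2).symm L with hv
  have hL : ∀ x, L x = inner ℝ v x := fun x => by rw [hv, InnerProductSpace.toDual_symm_apply]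
  have hn : ‖L‖ = ‖v‖ := by rw [hv, LinearIsometryEquiv.norm_map]
  have h2 : L (planePoint 1 0) ^ 2 + L (planePoint 0 1) ^ 2 = ‖L‖ ^ 2 := by
    rw [hn, EuclideanSpace.norm_sq_eq, hL, hL]
    simp [PiLp.inner_apply, Fin.sum_univ_two]
  rw [h2, ENNReal.ofReal_pow (norm_nonneg _), ofReal_norm, enorm_eq_nnnorm]

lemma steklovN_le_of_linearMap {Ω : Set E2} {a b : ℝ} (hab : a ≤ b)
    (hcl : horizontalSegment a b ⊆ closure Ω) {k : ℕ}
    (T : (Fin (k + 1) → ℝ) →ₗ[ℝ] (E2 → ℝ)) (hT : ∀ v, ContDiff ℝ (⊤ : ℕ∞) (T v))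
    (hpos : ∀ v, v ≠ 0 → 0 < ∫ x in a..b, T v (planePoint x 0) ^ 2)
    {M : ℝ} (hM : 0 ≤ M)
    (hE : ∀ v, dirEnergy Ω (T v) ≤
      ENNReal.ofReal (M * ∫ x in a..b, T v (planePoint x 0) ^ 2)) :
    steklovN Ω (horizontalSegment a b) k ≤ ENNReal.ofReal M := by
  have hzero : ∀ v, EqOn (T v) 0 (closure Ω) → v = 0 := by
    intro v hv
    by_contra hne
    refine (hpos v hne).ne' ?_
    have : ∀ x ∈ uIcc a b, T v (planePoint x 0) ^ 2 = 0 := by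
      intro x hx
      rw [uIcc_of_le hab] at hx
      have := hv (hcl (show planePoint x 0 ∈ horizontalSegment a b from ⟨rfl, hx.1, hx.2⟩))
      simp [this]
    rw [intervalIntegral.integral_congr this]
    simp
  have hinj : Function.Injective T := by
    rw [← LinearMap.ker_eq_bot, LinearMap.ker_eq_bot']
    intro v hv
    exact hzero v fun x _ => by rw [hv]
  refine iInf_le_of_le (LinearMap.range T) <| iInf_le_of_le ?_ <| iInf_le_of_le ?_ <|
    iInf_le_of_le ?_ <| iInf_le_of_le ?_ ?_
  · rw [LinearMap.finrank_range_of_inj hinj]; simp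
  · rintro _ ⟨v, rfl⟩; exact hT v
  · rintro _ ⟨v, rfl⟩; simp
  · rintro _ ⟨v, rfl⟩ hv
    rw [hzero v hv, map_zero]
  · refine iSup_le fun f => iSup_le fun hf => iSup_le fun _ => ?_
    obtain ⟨v, rfl⟩ := hf
    refine ENNReal.div_le_of_le_mul ?_
    rw [bdryInt_horizontalSegment hab (hT v).continuous, ← ENNReal.ofReal_mul hM]
    exact hE v

lemma dirEnergy_add_exp_mul (Ω : Set E2) (C c : ℝ) {ψ : ℝ → ℝ} (hψ : Differentiable ℝ ψ) :
    dirEnergy Ω (fun p => C + Real.exp (c * p 1) * ψ (p 0)) =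
      ∫⁻ p in Ω, ENNReal.ofReal
        (Real.exp (2 * c * p 1) * (deriv ψ (p 0) ^ 2 + c ^ 2 * ψ (p 0) ^ 2)) := by
  refine lintegral_congr fun p => ?_
  have h0 : HasFDerivAt (fun p : E2 => p 0) (EuclideanSpace.proj (𝕜 := ℝ) 0 : E2 →L[ℝ] ℝ) p :=
    (EuclideanSpace.proj (𝕜 := ℝ) 0 : E2 →L[ℝ] ℝ).hasFDerivAt
  have h1 : HasFDerivAt (fun p : E2 => p 1) (EuclideanSpace.proj (𝕜 := ℝ) 1 : E2 →L[ℝ] ℝ) p :=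
    (EuclideanSpace.proj (𝕜 := ℝ) 1 : E2 →L[ℝ] ℝ).hasFDerivAt
  have h := (((h1.const_mul c).exp.mul ((hψ (p 0)).hasDerivAt.comp_hasFDerivAt p h0))).const_add C
  have h' : fderiv ℝ (fun p : E2 => C + Real.exp (c * p 1) * ψ (p 0)) p = _ := h.fderiv
  rw [h', nnnorm_sq_dual_plane]
  congr 1
  have he : Real.exp (2 * c * p 1) = Real.exp (c * p 1) ^ 2 := by
    rw [← Real.exp_nat_mul]; congr 1; push_cast; ring
  rw [he]
  simp
  ring

lemma lintegral_exp_Iio {c : ℝ} (hc : 0 < c) :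
    ∫⁻ y in Iio (0 : ℝ), ENNReal.ofReal (Real.exp (c * y)) = ENNReal.ofReal (1 / c) := by
  rw [Measure.restrict_congr_set Iio_ae_eq_Iic, ← ofReal_integral_eq_lintegral_ofReal
    (integrableOn_exp_mul_Iic hc 0) (Eventually.of_forall fun y => (Real.exp_pos _).le),
    integral_exp_mul_Iic hc]
  simp

lemma lintegral_exp_mul_halfPlane {c : ℝ} (hc : 0 < c) {u : ℝ → ℝ≥0∞} (hu : Measurable u) :
    ∫⁻ p in {p : E2 | p 1 < 0}, ENNReal.ofReal (Real.exp (c * p 1)) * u (p 0) =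
      ENNReal.ofReal (1 / c) * ∫⁻ x, u x := by
  rw [setLIntegral_plane]
  have hs : {p : ℝ × ℝ | planePoint p.1 p.2 ∈ {p : E2 | p 1 < 0}} = univ ×ˢ Iio 0 := by
    ext p; simp
  simp only [hs, planePoint_apply_zero, planePoint_apply_one]
  rw [Measure.volume_eq_prod, ← Measure.prod_restrict, Measure.restrict_univ,
    ← lintegral_exp_Iio hc, mul_comm, ← lintegral_prod_mul hu.aemeasurable
      (by fun_prop)]
  simp only [mul_comm]

lemma integral_sq_add_cos_add_sin {a b c A B C : ℝ} (hc : c ≠ 0)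
    (hsin : Real.sin (c * (b - a)) = 0) (hcos : C = 0 ∨ Real.cos (c * (b - a)) = 1) :
    ∫ x in a..b, (C + (A * Real.cos (c * (x - a)) + B * Real.sin (c * (x - a)))) ^ 2 =
      (C ^ 2 + (A ^ 2 + B ^ 2) / 2) * (b - a) := by
  have hderiv : ∀ x ∈ uIcc a b, HasDerivAt (fun x => C ^ 2 * x
      + 2 * C / c * (A * Real.sin (c * (x - a)) - B * Real.cos (c * (x - a)))
      + A ^ 2 / 2 * (x + Real.sin (c * (x - a)) * Real.cos (c * (x - a)) / c)
      + B ^ 2 / 2 * (x - Real.sin (c * (x - a)) * Real.cos (c * (x - a)) / c)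
      + A * B / c * Real.sin (c * (x - a)) ^ 2)
      ((C + (A * Real.cos (c * (x - a)) + B * Real.sin (c * (x - a)))) ^ 2) x := by
    intro x _
    have hl : HasDerivAt (fun x => c * (x - a)) c x := by
      simpa using ((hasDerivAt_id x).sub_const a).const_mul c
    have hs := hl.sin
    have hk := hl.cos
    have hi := hasDerivAt_id x
    have h := ((((hi.const_mul (C ^ 2)).add
      (((hs.const_mul A).sub (hk.const_mul B)).const_mul (2 * C / c))).add
      ((hi.add ((hs.mul hk).div_const c)).const_mul (A ^ 2 / 2))).add
      ((hi.sub ((hs.mul hk).div_const c)).const_mul (B ^ 2 / 2))).add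
      ((hs.pow 2).const_mul (A * B / c))
    refine h.congr_deriv ?_
    have e := Real.sin_sq_add_cos_sq (c * (x - a))
    generalize Real.sin (c * (x - a)) = s at e ⊢
    generalize Real.cos (c * (x - a)) = t at e ⊢
    push_cast
    field_simp
    linear_combination -(A ^ 2 + B ^ 2) * e
  rw [intervalIntegral.integral_eq_sub_of_hasDerivAt hderiv
    (Continuous.intervalIntegrable (by fun_prop) _ _)]
  rcases hcos with rfl | hcos
  · simp [hsin]; ring
  · simp [hsin, hcos]; ring

lemma dirEnergy_exp_trig_le {Ω : Set E2} {a b c : ℝ} (hc : 0 < c)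
    (hJohn : ∫⁻ p in Ω, ENNReal.ofReal (Real.exp (2 * c * p 1)) ≤
      ENNReal.ofReal ((b - a) / (2 * c))) (A B C : ℝ) :
    dirEnergy Ω (fun p => C + Real.exp (c * p 1) *
      (A * Real.cos (c * (p 0 - a)) + B * Real.sin (c * (p 0 - a)))) ≤
      ENNReal.ofReal (c * ((A ^ 2 + B ^ 2) / 2 * (b - a))) := by
  have hd (x : ℝ) : HasDerivAt (fun x => A * Real.cos (c * (x - a)) + B * Real.sin (c * (x - a)))
      (A * (-Real.sin (c * (x - a)) * c) + B * (Real.cos (c * (x - a)) * c)) x := by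
    have hl : HasDerivAt (fun x => c * (x - a)) c x := by
      simpa using ((hasDerivAt_id x).sub_const a).const_mul c
    exact (hl.cos.const_mul A).add (hl.sin.const_mul B)
  have hsum (x : ℝ) :
      (A * (-Real.sin (c * (x - a)) * c) + B * (Real.cos (c * (x - a)) * c)) ^ 2
      + c ^ 2 * (A * Real.cos (c * (x - a)) + B * Real.sin (c * (x - a))) ^ 2 =
      c ^ 2 * (A ^ 2 + B ^ 2) := by
    linear_combination c ^ 2 * (A ^ 2 + B ^ 2) * Real.sin_sq_add_cos_sq (c * (x - a))
  have hnn : 0 ≤ c ^ 2 * (A ^ 2 + B ^ 2) := by positivity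
  have h := dirEnergy_add_exp_mul Ω C c fun x => (hd x).differentiableAt
  simp only [(hd _).deriv, hsum, ENNReal.ofReal_mul (Real.exp_pos _).le] at h
  rw [h, lintegral_mul_const _ (by fun_prop)]
  calc _ ≤ ENNReal.ofReal ((b - a) / (2 * c)) * ENNReal.ofReal (c ^ 2 * (A ^ 2 + B ^ 2)) := by
        gcongr
    _ = _ := by
        rw [← ENNReal.ofReal_mul' hnn]
        congr 1
        field_simp

lemma contDiff_exp_trig (a c A B C : ℝ) : ContDiff ℝ (⊤ : ℕ∞) fun p : E2 =>
    C + Real.exp (c * p 1) *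
      (A * Real.cos (c * (p 0 - a)) + B * Real.sin (c * (p 0 - a))) := by
  have h (i : Fin 2) : ContDiff ℝ (⊤ : ℕ∞) fun p : E2 => p i := by fun_prop
  have h0 := h 0
  have h1 := h 1
  fun_prop

lemma steklovN_one_le {Ω : Set E2} {a b : ℝ} (hab : a < b)
    (hcl : horizontalSegment a b ⊆ closure Ω)
    (hJohn : ∀ c : ℝ, 0 < c →
      ∫⁻ p in Ω, ENNReal.ofReal (Real.exp (c * p 1)) ≤ ENNReal.ofReal ((b - a) / c)) :
    steklovN Ω (horizontalSegment a b) 1 ≤ ENNReal.ofReal (Real.pi / (b - a)) := by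
  have hl : 0 < b - a := sub_pos.2 hab
  set c := Real.pi / (b - a) with hcdef
  have hc : 0 < c := by positivity
  have hcl' : c * (b - a) = Real.pi := by rw [hcdef]; field_simp
  let T : (Fin 2 → ℝ) →ₗ[ℝ] (E2 → ℝ) :=
    { toFun := fun v p => 0 + Real.exp (c * p 1) *
        (v 0 * Real.cos (c * (p 0 - a)) + v 1 * Real.sin (c * (p 0 - a)))
      map_add' := fun v w => by ext p; simp; ring
      map_smul' := fun r v => by ext p; simp; ring }
  have hInt (v : Fin 2 → ℝ) : ∫ x in a..b, T v (planePoint x 0) ^ 2 =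
      (v 0 ^ 2 + v 1 ^ 2) / 2 * (b - a) := by
    have h := integral_sq_add_cos_add_sin (a := a) (b := b) (A := v 0) (B := v 1) (C := 0) hc.ne'
      (by rw [hcl', Real.sin_pi]) (Or.inl rfl)
    simpa [T] using h
  refine steklovN_le_of_linearMap hab.le hcl T (fun v => contDiff_exp_trig a c (v 0) (v 1) 0)
    (fun v hv => ?_) hc.le fun v => ?_
  · rw [hInt]
    have : v 0 ≠ 0 ∨ v 1 ≠ 0 := by
      by_contra! h
      exact hv (by ext i; fin_cases i <;> simp [h])
    rcases this with h | h <;> positivity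
  · rw [hInt]
    exact dirEnergy_exp_trig_le hc (hJohn _ (by positivity)) (v 0) (v 1) 0

lemma steklovN_two_le {Ω : Set E2} {a b : ℝ} (hab : a < b)
    (hcl : horizontalSegment a b ⊆ closure Ω)
    (hJohn : ∀ c : ℝ, 0 < c →
      ∫⁻ p in Ω, ENNReal.ofReal (Real.exp (c * p 1)) ≤ ENNReal.ofReal ((b - a) / c)) :
    steklovN Ω (horizontalSegment a b) 2 ≤ ENNReal.ofReal (2 * Real.pi / (b - a)) := by
  have hl : 0 < b - a := sub_pos.2 hab
  set c := 2 * Real.pi / (b - a) with hcdef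
  have hc : 0 < c := by positivity
  have hcl' : c * (b - a) = 2 * Real.pi := by rw [hcdef]; field_simp
  let T : (Fin 3 → ℝ) →ₗ[ℝ] (E2 → ℝ) :=
    { toFun := fun v p => v 2 + Real.exp (c * p 1) *
        (v 0 * Real.cos (c * (p 0 - a)) + v 1 * Real.sin (c * (p 0 - a)))
      map_add' := fun v w => by ext p; simp; ring
      map_smul' := fun r v => by ext p; simp; ring }
  have hInt (v : Fin 3 → ℝ) : ∫ x in a..b, T v (planePoint x 0) ^ 2 =
      (v 2 ^ 2 + (v 0 ^ 2 + v 1 ^ 2) / 2) * (b - a) := by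
    have h := integral_sq_add_cos_add_sin (a := a) (b := b) (A := v 0) (B := v 1) (C := v 2)
      hc.ne' (by rw [hcl', Real.sin_two_pi]) (Or.inr (by rw [hcl', Real.cos_two_pi]))
    simpa [T] using h
  refine steklovN_le_of_linearMap hab.le hcl T (fun v => contDiff_exp_trig a c (v 0) (v 1) (v 2))
    (fun v hv => ?_) hc.le fun v => ?_
  · rw [hInt]
    have : v 0 ≠ 0 ∨ v 1 ≠ 0 ∨ v 2 ≠ 0 := by
      by_contra! h
      exact hv (by ext i; fin_cases i <;> simp [h])
    rcases this with h | h | h <;> positivity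
  · rw [hInt]
    refine (dirEnergy_exp_trig_le hc (hJohn _ (by positivity)) (v 0) (v 1) (v 2)).trans ?_
    gcongr
    exact le_add_of_nonneg_left (sq_nonneg _)

/-- A smooth bump on the unit interval, close in energy to `x * (1 - x)`. -/
def unitBump (x : ℝ) : ℝ := x * (1 - x) * expNegInvGlue (100 * (x * (1 - x)))

lemma contDiff_unitBump : ContDiff ℝ (⊤ : ℕ∞) unitBump := by
  unfold unitBump
  have := expNegInvGlue.contDiff (n := ⊤)
  fun_prop

lemma unitBump_eq_zero {x : ℝ} (hx : x ∉ Ioo (0 : ℝ) 1) : unitBump x = 0 := by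
  rw [unitBump, expNegInvGlue.zero_of_nonpos, mul_zero]
  by_contra! h
  exact hx ⟨by nlinarith, by nlinarith⟩

lemma unitBump_nonneg (x : ℝ) : 0 ≤ unitBump x := by
  by_cases hx : x ∈ Ioo (0 : ℝ) 1
  · exact mul_nonneg (mul_nonneg hx.1.le (sub_nonneg.2 hx.2.le)) (expNegInvGlue.nonneg _)
  · exact (unitBump_eq_zero hx).ge

lemma deriv_unitBump_eq_zero {x : ℝ} (hx : unitBump x = 0) : deriv unitBump x = 0 :=
  IsLocalMin.deriv_eq_zero <| Eventually.of_forall fun y => hx ▸ unitBump_nonneg y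

lemma deriv_unitBump_sq_le {x : ℝ} (hx : x ∈ Ioo (0 : ℝ) 1) :
    deriv unitBump x ^ 2 ≤ (1 - 2 * x) ^ 2 := by
  have hs : 0 < x * (1 - x) := mul_pos hx.1 (sub_pos.2 hx.2)
  have hq : HasDerivAt (fun x : ℝ => x * (1 - x)) (1 - 2 * x) x := by
    have := (hasDerivAt_id x).mul ((hasDerivAt_id x).const_sub 1)
    refine this.congr_deriv ?_
    simp; ring
  have hd : HasDerivAt unitBump _ x :=
    (hq.mul (((hq.const_mul 100).inv (by positivity)).neg.exp)).congr_of_eventuallyEq (by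
      filter_upwards [isOpen_Ioo.mem_nhds hx] with y hy
      have hy' : 0 < y * (1 - y) := mul_pos hy.1 (sub_pos.2 hy.2)
      rw [unitBump, expNegInvGlue, if_neg (by linarith)]
      rfl)
  rw [hd.deriv]
  set s := x * (1 - x) with hsdef
  have hu : 0 < (100 * s)⁻¹ := by positivity
  have hk : (1 + (100 * s)⁻¹) * Real.exp (-(100 * s)⁻¹) ≤ 1 := by
    rw [Real.exp_neg, ← div_eq_mul_inv, div_le_one (Real.exp_pos _), add_comm]
    exact Real.add_one_le_exp _
  have hk0 : 0 ≤ (1 + (100 * s)⁻¹) * Real.exp (-(100 * s)⁻¹) := by positivity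
  calc _ = ((1 - 2 * x) * ((1 + (100 * s)⁻¹) * Real.exp (-(100 * s)⁻¹))) ^ 2 := by
        congr 1
        simp only [Pi.neg_apply, Pi.inv_apply]
        generalize Real.exp _ = E
        field_simp
    _ ≤ _ := by
        rw [mul_pow]
        exact mul_le_of_le_one_right (sq_nonneg _) (pow_le_one₀ hk0 hk)

lemma le_unitBump_sq {x : ℝ} (hx : x ∈ Icc (0 : ℝ) 1) :
    (x * (1 - x)) ^ 2 - x * (1 - x) / 50 ≤ unitBump x ^ 2 := by
  rcases (mul_nonneg hx.1 (sub_nonneg.2 hx.2)).eq_or_lt with hs | hs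
  · rw [← hs]; simpa using sq_nonneg _
  · have hE : expNegInvGlue (100 * (x * (1 - x))) = Real.exp (-(100 * (x * (1 - x)))⁻¹) := by
      rw [expNegInvGlue, if_neg (by linarith)]
    rw [unitBump, hE]
    set s := x * (1 - x)
    have h : 1 - 2 * (100 * s)⁻¹ ≤ Real.exp (-(100 * s)⁻¹) ^ 2 := by
      rw [← Real.exp_nat_mul]
      have := Real.add_one_le_exp (((2 : ℕ) : ℝ) * -(100 * s)⁻¹)
      push_cast at this ⊢
      linarith
    calc _ = s ^ 2 * (1 - 2 * (100 * s)⁻¹) := by field_simp; ring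
      _ ≤ s ^ 2 * Real.exp (-(100 * s)⁻¹) ^ 2 := mul_le_mul_of_nonneg_left h (sq_nonneg _)
      _ = _ := (mul_pow _ _ _).symm

lemma integral_Icc_of_vanishing {a b : ℝ} (hab : a ≤ b) {g : ℝ → ℝ}
    (hg : ∀ x ∉ Icc a b, g x = 0) : ∫ x, g x = ∫ x in a..b, g x := by
  rw [intervalIntegral.integral_of_le hab, ← integral_Icc_eq_integral_Ioc,
    setIntegral_eq_integral_of_forall_compl_eq_zero hg]

lemma unitBump_eq_zero_of_notMem_Icc {x : ℝ} (hx : x ∉ Icc (0 : ℝ) 1) : unitBump x = 0 :=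
  unitBump_eq_zero fun h => hx (Ioo_subset_Icc_self h)

lemma le_integral_unitBump_sq : 3 / 100 ≤ ∫ x, unitBump x ^ 2 := by
  rw [integral_Icc_of_vanishing zero_le_one fun x hx => by
    rw [unitBump_eq_zero_of_notMem_Icc hx, zero_pow two_ne_zero]]
  have hc := contDiff_unitBump.continuous
  calc (3 / 100 : ℝ) = ∫ x in (0 : ℝ)..1, ((x * (1 - x)) ^ 2 - x * (1 - x) / 50) := by
        have h : ∀ x ∈ uIcc (0 : ℝ) 1, HasDerivAt
            (fun x : ℝ => x ^ 3 / 3 - x ^ 4 / 2 + x ^ 5 / 5 - x ^ 2 / 100 + x ^ 3 / 150)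
            ((x * (1 - x)) ^ 2 - x * (1 - x) / 50) x := by
          intro x _
          have h (n : ℕ) (r : ℝ) := (hasDerivAt_pow n x).div_const r
          refine (((((h 3 3).sub (h 4 2)).add (h 5 5)).sub (h 2 100)).add
            (h 3 150)).congr_deriv ?_
          push_cast; ring
        rw [intervalIntegral.integral_eq_sub_of_hasDerivAt h
          (Continuous.intervalIntegrable (by fun_prop) _ _)]
        norm_num
    _ ≤ _ := intervalIntegral.integral_mono_on zero_le_one
        (Continuous.intervalIntegrable (by fun_prop) _ _)
        (Continuous.intervalIntegrable (by fun_prop) _ _) fun x hx => le_unitBump_sq hx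

lemma integral_deriv_unitBump_sq_le :
    ∫ x, deriv unitBump x ^ 2 ≤ 100 / 9 * ∫ x, unitBump x ^ 2 := by
  have hc : Continuous (deriv unitBump) := contDiff_unitBump.continuous_deriv (by simp)
  suffices h : ∫ x, deriv unitBump x ^ 2 ≤ 1 / 3 by linarith [le_integral_unitBump_sq]
  rw [integral_Icc_of_vanishing zero_le_one fun x hx => by
    rw [deriv_unitBump_eq_zero (unitBump_eq_zero_of_notMem_Icc hx), zero_pow two_ne_zero]]
  calc _ ≤ ∫ x in (0 : ℝ)..1, (1 - 2 * x) ^ 2 := by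
        refine intervalIntegral.integral_mono_on_of_le_Ioo zero_le_one
          (Continuous.intervalIntegrable (by fun_prop) _ _)
          (Continuous.intervalIntegrable (by fun_prop) _ _) fun x hx => deriv_unitBump_sq_le hx
    _ = 1 / 3 := by
        have h : ∀ x ∈ uIcc (0 : ℝ) 1, HasDerivAt
            (fun x : ℝ => x - 2 * x ^ 2 + 4 / 3 * x ^ 3) ((1 - 2 * x) ^ 2) x := by
          intro x _
          refine (((hasDerivAt_id x).sub ((hasDerivAt_pow 2 x).const_mul 2)).add
            ((hasDerivAt_pow 3 x).const_mul (4 / 3))).congr_deriv ?_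
          push_cast; ring
        rw [intervalIntegral.integral_eq_sub_of_hasDerivAt h
          (Continuous.intervalIntegrable (by fun_prop) _ _)]
        norm_num

lemma sq_sum_of_pairwise_mul_eq_zero {ι : Type*} (s : Finset ι) (g : ι → ℝ)
    (h : ∀ i j, i ≠ j → g i * g j = 0) : (∑ i ∈ s, g i) ^ 2 = ∑ i ∈ s, g i ^ 2 := by
  rw [sq, Finset.sum_mul_sum]
  refine Finset.sum_congr rfl fun i hi => ?_
  rw [Finset.sum_eq_single i (fun j _ hj => h i j hj.symm) fun h => absurd hi h, sq]

lemma unitBump_sub_mul_unitBump_sub {n : ℕ} {i j : Fin n} (hij : i ≠ j) (t : ℝ) :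
    unitBump (t - i) = 0 ∨ unitBump (t - j) = 0 := by
  by_contra! h
  have hi := not_imp_comm.1 unitBump_eq_zero h.1
  have hj := not_imp_comm.1 unitBump_eq_zero h.2
  simp only [mem_Ioo] at hi hj
  have h1 : ((i : ℕ) : ℝ) < (j : ℕ) + 1 := by linarith
  have h2 : ((j : ℕ) : ℝ) < (i : ℕ) + 1 := by linarith
  norm_cast at h1 h2
  exact hij (Fin.ext (by lia))

lemma hasCompactSupport_of_unitBump_eq_zero {g : ℝ → ℝ} (hg : ∀ x, unitBump x = 0 → g x = 0) :
    HasCompactSupport g :=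
  HasCompactSupport.of_support_subset_isCompact (isCompact_Icc (a := (0 : ℝ)) (b := 1))
    fun x hx => by
      by_contra h
      exact hx (hg x (unitBump_eq_zero_of_notMem_Icc h))

lemma integrable_comp_affine {g : ℝ → ℝ} (hg : Integrable g) (a r : ℝ) {w : ℝ} (hw : 0 < w) :
    Integrable fun x => g ((x - a) / w - r) :=
  ((hg.comp_sub_right r).comp_div hw.ne').comp_sub_right a

lemma integral_comp_affine (g : ℝ → ℝ) (a r : ℝ) {w : ℝ} (hw : 0 < w) :
    ∫ x, g ((x - a) / w - r) = w * ∫ x, g x := by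
  rw [integral_sub_right_eq_self (fun x => g (x / w - r)) a,
    Measure.integral_comp_div (fun x => g (x - r)) w, integral_sub_right_eq_self g r,
    abs_of_pos hw, smul_eq_mul]

/-- A linear combination of `n` adjacent bumps of width `w` starting at `a`. -/
def bumpSum {n : ℕ} (a w : ℝ) (v : Fin n → ℝ) (x : ℝ) : ℝ :=
  ∑ i, v i * unitBump ((x - a) / w - i)

section BumpSum

variable {n : ℕ} (a : ℝ) {w : ℝ} (v : Fin n → ℝ)

lemma contDiff_bumpSum (w : ℝ) : ContDiff ℝ (⊤ : ℕ∞) (bumpSum a w v) := by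
  unfold bumpSum
  refine ContDiff.sum fun i _ => contDiff_const.mul (contDiff_unitBump.comp ?_)
  fun_prop

lemma deriv_bumpSum (x : ℝ) : deriv (bumpSum a w v) x =
    ∑ i, v i * (deriv unitBump ((x - a) / w - i) / w) := by
  have h : HasDerivAt (bumpSum a w v) _ x := HasDerivAt.fun_sum fun i _ =>
    (((contDiff_unitBump.differentiable (by simp) _).hasDerivAt.comp x
      ((((hasDerivAt_id x).sub_const a).div_const w).sub_const (i : ℝ)))).const_mul (v i)
  rw [h.deriv]
  refine Finset.sum_congr rfl fun i _ => ?_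
  simp [div_eq_mul_inv]

lemma bumpSum_sq (x : ℝ) :
    bumpSum a w v x ^ 2 = ∑ i, v i ^ 2 * unitBump ((x - a) / w - i) ^ 2 := by
  rw [bumpSum, sq_sum_of_pairwise_mul_eq_zero]
  · simp only [mul_pow]
  · intro i j hij
    rcases unitBump_sub_mul_unitBump_sub hij ((x - a) / w) with h | h <;> simp [h]

lemma deriv_bumpSum_sq (x : ℝ) : deriv (bumpSum a w v) x ^ 2 =
    ∑ i, v i ^ 2 * (deriv unitBump ((x - a) / w - i) ^ 2 / w ^ 2) := by
  rw [deriv_bumpSum, sq_sum_of_pairwise_mul_eq_zero]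
  · simp only [mul_pow, div_pow]
  · intro i j hij
    rcases unitBump_sub_mul_unitBump_sub hij ((x - a) / w) with h | h <;>
      simp [deriv_unitBump_eq_zero h]

lemma integrable_unitBump_sq : Integrable fun x => unitBump x ^ 2 :=
  (contDiff_unitBump.continuous.pow 2).integrable_of_hasCompactSupport
    (hasCompactSupport_of_unitBump_eq_zero fun x hx => by simp [hx])

lemma integrable_deriv_unitBump_sq : Integrable fun x => deriv unitBump x ^ 2 :=
  ((contDiff_unitBump.continuous_deriv (by simp)).pow 2).integrable_of_hasCompactSupport
    (hasCompactSupport_of_unitBump_eq_zero fun x hx => by simp [deriv_unitBump_eq_zero hx])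

lemma integrable_bumpSum_sq (hw : 0 < w) : Integrable fun x => bumpSum a w v x ^ 2 := by
  simp only [bumpSum_sq]
  exact integrable_finsetSum _ fun i _ =>
    (integrable_comp_affine integrable_unitBump_sq a i hw).const_mul _

lemma integrable_deriv_bumpSum_sq (hw : 0 < w) :
    Integrable fun x => deriv (bumpSum a w v) x ^ 2 := by
  simp only [deriv_bumpSum_sq]
  exact integrable_finsetSum _ fun i _ =>
    ((integrable_comp_affine integrable_deriv_unitBump_sq a i hw).div_const _).const_mul _

lemma integral_bumpSum_sq (hw : 0 < w) : ∫ x, bumpSum a w v x ^ 2 =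
    (∑ i, v i ^ 2) * (w * ∫ x, unitBump x ^ 2) := by
  simp only [bumpSum_sq]
  rw [integral_finsetSum _ fun (i : Fin n) _ =>
    (integrable_comp_affine integrable_unitBump_sq a i hw).const_mul _, Finset.sum_mul]
  refine Finset.sum_congr rfl fun i _ => ?_
  rw [integral_const_mul, integral_comp_affine (fun x => unitBump x ^ 2) a i hw]

lemma integral_deriv_bumpSum_sq (hw : 0 < w) : ∫ x, deriv (bumpSum a w v) x ^ 2 =
    (∑ i, v i ^ 2) * ((∫ x, deriv unitBump x ^ 2) / w) := by
  simp only [deriv_bumpSum_sq]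
  rw [integral_finsetSum _ fun (i : Fin n) _ =>
    ((integrable_comp_affine integrable_deriv_unitBump_sq a i hw).div_const _).const_mul _,
    Finset.sum_mul]
  refine Finset.sum_congr rfl fun i _ => ?_
  rw [integral_const_mul, integral_div,
    integral_comp_affine (fun x => deriv unitBump x ^ 2) a i hw]
  field_simp

lemma integral_deriv_bumpSum_sq_le (hw : 0 < w) : ∫ x, deriv (bumpSum a w v) x ^ 2 ≤
    (10 / (3 * w)) ^ 2 * ∫ x, bumpSum a w v x ^ 2 := by
  rw [integral_bumpSum_sq a v hw, integral_deriv_bumpSum_sq a v hw]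
  calc _ ≤ (∑ i, v i ^ 2) * ((100 / 9 * ∫ x, unitBump x ^ 2) / w) := by
        have := integral_deriv_unitBump_sq_le
        gcongr
    _ = _ := by field_simp; ring

lemma bumpSum_eq_zero {b : ℝ} (hw : 0 < w) (hb : b = a + n * w) {x : ℝ} (hx : x ∉ Icc a b) :
    bumpSum a w v x = 0 := by
  refine Finset.sum_eq_zero fun i _ => ?_
  rw [unitBump_eq_zero, mul_zero]
  rintro ⟨h1, h2⟩
  refine hx ⟨?_, ?_⟩
  · have : 0 < (x - a) / w := by linarith [Nat.cast_nonneg (α := ℝ) (i : ℕ)]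
    rw [div_pos_iff_of_pos_right hw] at this
    linarith
  · have hi : ((i : ℕ) : ℝ) + 1 ≤ n := by exact_mod_cast i.2
    have : (x - a) / w ≤ n := by linarith
    rw [div_le_iff₀ hw] at this
    linarith

lemma integral_bumpSum_sq_pos (hw : 0 < w) {v : Fin n → ℝ} (hv : v ≠ 0) :
    0 < ∫ x, bumpSum a w v x ^ 2 := by
  rw [integral_bumpSum_sq a v hw]
  obtain ⟨i, hi⟩ := Function.ne_iff.1 hv
  have hi : v i ≠ 0 := hi
  have h1 : 0 < ∑ i, v i ^ 2 :=
    Finset.sum_pos' (fun i _ => sq_nonneg _) ⟨i, Finset.mem_univ i, by positivity⟩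
  have := le_integral_unitBump_sq
  positivity

end BumpSum

lemma dirEnergy_exp_mul_bumpSum_le {Ω : Set E2} (hlow : Ω ⊆ {p : E2 | p 1 < 0}) (a : ℝ) {w : ℝ}
    (hw : 0 < w) {n : ℕ} (v : Fin n → ℝ) :
    dirEnergy Ω (fun p => 0 + Real.exp (10 / (3 * w) * p 1) * bumpSum a w v (p 0)) ≤
      ENNReal.ofReal (10 / (3 * w) * ∫ x, bumpSum a w v x ^ 2) := by
  have hψ := contDiff_bumpSum a v w
  have hψc : Continuous (bumpSum a w v) := hψ.continuous
  have hψ' : Continuous (deriv (bumpSum a w v)) := hψ.continuous_deriv (by simp)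
  set c := 10 / (3 * w) with hcdef
  have hc : 0 < c := by positivity
  rw [dirEnergy_add_exp_mul Ω 0 c (hψ.differentiable (by simp))]
  simp only [ENNReal.ofReal_mul (Real.exp_pos _).le]
  refine (lintegral_mono_set hlow).trans ?_
  rw [lintegral_exp_mul_halfPlane (by positivity : 0 < 2 * c)
    (u := fun x => ENNReal.ofReal (deriv (bumpSum a w v) x ^ 2 + c ^ 2 * bumpSum a w v x ^ 2))
    (ENNReal.measurable_ofReal.comp (Continuous.measurable (by fun_prop)))]
  have i1 := integrable_deriv_bumpSum_sq a v hw
  have i2 := (integrable_bumpSum_sq a v hw).const_mul (c ^ 2)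
  have i3 : Integrable fun x => deriv (bumpSum a w v) x ^ 2 + c ^ 2 * bumpSum a w v x ^ 2 :=
    i1.add i2
  rw [← ofReal_integral_eq_lintegral_ofReal i3
    (Eventually.of_forall fun x => by positivity), ← ENNReal.ofReal_mul (by positivity)]
  refine ENNReal.ofReal_le_ofReal ?_
  rw [integral_add i1 i2, integral_const_mul]
  have h := integral_deriv_bumpSum_sq_le a v hw
  rw [← hcdef] at h
  calc _ ≤ 1 / (2 * c) * (c ^ 2 * (∫ x, bumpSum a w v x ^ 2)
        + c ^ 2 * (∫ x, bumpSum a w v x ^ 2)) := by gcongr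
    _ = _ := by field_simp; ring

lemma steklovN_le_of_subset_halfPlane {Ω : Set E2} {a b : ℝ} (hab : a < b)
    (hcl : horizontalSegment a b ⊆ closure Ω) (hlow : Ω ⊆ {p : E2 | p 1 < 0}) (k : ℕ) :
    steklovN Ω (horizontalSegment a b) k ≤
      ENNReal.ofReal (10 / 3 * (k + 1) / (b - a)) := by
  have hl : 0 < b - a := sub_pos.2 hab
  set w := (b - a) / (k + 1) with hwdef
  have hw : 0 < w := by positivity
  have hM : 10 / 3 * (k + 1) / (b - a) = 10 / (3 * w) := by rw [hwdef]; field_simp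
  have hb : b = a + ((k + 1 : ℕ) : ℝ) * w := by rw [hwdef]; push_cast; field_simp; ring
  let T : (Fin (k + 1) → ℝ) →ₗ[ℝ] (E2 → ℝ) :=
    { toFun := fun v p => 0 + Real.exp (10 / (3 * w) * p 1) * bumpSum a w v (p 0)
      map_add' := fun v v' => by
        ext p
        simp [bumpSum, add_mul, Finset.sum_add_distrib, mul_add]
      map_smul' := fun r v => by
        ext p
        simp [bumpSum, mul_assoc, ← Finset.mul_sum, mul_left_comm] }
  have hInt (v : Fin (k + 1) → ℝ) :
      ∫ x in a..b, T v (planePoint x 0) ^ 2 = ∫ x, bumpSum a w v x ^ 2 := by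
    rw [integral_Icc_of_vanishing hab.le fun x hx => by
      rw [bumpSum_eq_zero a v hw hb hx, zero_pow two_ne_zero]]
    simp [T]
  rw [hM]
  refine steklovN_le_of_linearMap hab.le hcl T (fun v => ?_) (fun v hv => ?_) (by positivity)
    fun v => ?_
  · have h (i : Fin 2) : ContDiff ℝ (⊤ : ℕ∞) fun p : E2 => p i := by fun_prop
    have h1 := h 1
    exact contDiff_const.add ((Real.contDiff_exp.comp (contDiff_const.mul h1)).mul
      ((contDiff_bumpSum a v w).comp (h 0)))
  · rw [hInt]
    exact integral_bumpSum_sq_pos a hw hv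
  · rw [hInt]
    exact dirEnergy_exp_mul_bumpSum_le hlow a hw v

lemma dirichlet_wirtinger {a b c : ℝ} (hab : a < b) (hc : 0 < c) (hcπ : c * (b - a) < Real.pi)
    {G g : ℝ → ℝ} (hG : ∀ x, HasDerivAt G (g x) x) (hg : Continuous g)
    (hGa : G a = 0) (hGb : G b = 0) :
    c ^ 2 * ∫ x in a..b, G x ^ 2 ≤ ∫ x in a..b, g x ^ 2 := by
  have hGc : Continuous G := continuous_iff_continuousAt.2 fun x => (hG x).continuousAt
  set τ : ℝ → ℝ := fun x => c * Real.tan (c * (x - (a + b) / 2)) with hτdef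
  have hcos : ∀ x ∈ Icc a b, Real.cos (c * (x - (a + b) / 2)) ≠ 0 := by
    intro x hx
    refine (Real.cos_pos_of_mem_Ioo ⟨?_, ?_⟩).ne'
    · nlinarith [mul_le_mul_of_nonneg_left hx.1 hc.le]
    · nlinarith [mul_le_mul_of_nonneg_left hx.2 hc.le]
  have hτ : ∀ x ∈ Icc a b, HasDerivAt τ (c ^ 2 + τ x ^ 2) x := by
    intro x hx
    have hl : HasDerivAt (fun x => c * (x - (a + b) / 2)) c x := by
      simpa using ((hasDerivAt_id x).sub_const ((a + b) / 2)).const_mul c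
    refine (((Real.hasDerivAt_tan (hcos x hx)).comp x hl).const_mul c).congr_deriv ?_
    have h := Real.inv_one_add_tan_sq (hcos x hx)
    simp only [hτdef]
    rw [← h]
    field_simp
  have hτc : ContinuousOn τ (Icc a b) := fun x hx => (hτ x hx).continuousAt.continuousWithinAt
  have hInt : ∀ {u : ℝ → ℝ}, ContinuousOn u (Icc a b) → IntervalIntegrable u volume a b :=
    fun hu => hu.intervalIntegrable_of_Icc hab.le
  have hz : ∫ x in a..b, (c ^ 2 + τ x ^ 2) * G x ^ 2 + τ x * (2 * G x * g x) = 0 := by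
    rw [intervalIntegral.integral_eq_sub_of_hasDerivAt (f := fun x => τ x * G x ^ 2)]
    · simp [hGa, hGb]
    · intro x hx
      rw [uIcc_of_le hab.le] at hx
      refine ((hτ x hx).mul ((hG x).pow 2)).congr_deriv ?_
      push_cast
      simp
    · exact hInt (by fun_prop)
  have hnn : 0 ≤ ∫ x in a..b, (g x + τ x * G x) ^ 2 :=
    intervalIntegral.integral_nonneg hab.le fun x _ => sq_nonneg _
  have hE : ∫ x in a..b, (g x + τ x * G x) ^ 2 =
      (∫ x in a..b, g x ^ 2) - c ^ 2 * (∫ x in a..b, G x ^ 2)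
      + ∫ x in a..b, (c ^ 2 + τ x ^ 2) * G x ^ 2 + τ x * (2 * G x * g x) := by
    rw [← intervalIntegral.integral_const_mul, ← intervalIntegral.integral_sub
      (hInt (by fun_prop)) (hInt (by fun_prop)), ← intervalIntegral.integral_add
      (hInt (by fun_prop)) (hInt (by fun_prop))]
    exact intervalIntegral.integral_congr fun x _ => by ring
  linarith

lemma integral_sub_mean_sq {a b : ℝ} (hab : a < b) {p : ℝ → ℝ} (hp : Continuous p) :
    ∫ x in a..b, (p x - (∫ x in a..b, p x) / (b - a)) ^ 2 =
      (∫ x in a..b, p x ^ 2) - (∫ x in a..b, p x) ^ 2 / (b - a) := by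
  have hl : b - a ≠ 0 := (sub_pos.2 hab).ne'
  set m := (∫ x in a..b, p x) / (b - a) with hm
  have hInt : ∀ {u : ℝ → ℝ}, Continuous u → IntervalIntegrable u volume a b :=
    fun hu => hu.intervalIntegrable a b
  have h : ∫ x in a..b, (p x - m) ^ 2 =
      (∫ x in a..b, p x ^ 2) - 2 * m * (∫ x in a..b, p x) + ∫ x in a..b, m ^ 2 := by
    rw [← intervalIntegral.integral_const_mul, ← intervalIntegral.integral_sub
      (hInt (by fun_prop)) (hInt (by fun_prop)), ← intervalIntegral.integral_add
      (hInt (by fun_prop)) (hInt (by fun_prop))]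
    exact intervalIntegral.integral_congr fun x _ => by ring
  rw [h, intervalIntegral.integral_const, smul_eq_mul, hm]
  field_simp
  ring

lemma neumann_wirtinger {a b c : ℝ} (hab : a < b) (hc : 0 < c) (hcπ : c * (b - a) < Real.pi)
    {p q : ℝ → ℝ} (hp : ∀ x, HasDerivAt p (q x) x) (hq : Continuous q) :
    c ^ 2 * ((∫ x in a..b, p x ^ 2) - (∫ x in a..b, p x) ^ 2 / (b - a)) ≤
      ∫ x in a..b, q x ^ 2 := by
  have hl : b - a ≠ 0 := (sub_pos.2 hab).ne'
  have hpc : Continuous p := continuous_iff_continuousAt.2 fun x => (hp x).continuousAt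
  have hInt : ∀ {u : ℝ → ℝ}, Continuous u → IntervalIntegrable u volume a b :=
    fun hu => hu.intervalIntegrable a b
  rw [← integral_sub_mean_sq hab hpc]
  set m := (∫ x in a..b, p x) / (b - a) with hm
  set g : ℝ → ℝ := fun x => p x - m with hgdef
  have hgc : Continuous g := by fun_prop
  have hg : ∀ x, HasDerivAt g (q x) x := fun x => (hp x).sub_const m
  set G : ℝ → ℝ := fun x => ∫ t in a..x, g t with hGdef
  have hG : ∀ x, HasDerivAt G (g x) x := fun x => hgc.integral_hasStrictDerivAt a x |>.hasDerivAt
  have hGc : Continuous G := continuous_iff_continuousAt.2 fun x => (hG x).continuousAt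
  have hGa : G a = 0 := intervalIntegral.integral_same
  have hGb : G b = 0 := by
    simp only [hGdef, hgdef]
    rw [intervalIntegral.integral_sub (hInt hpc) (hInt continuous_const),
      intervalIntegral.integral_const, smul_eq_mul, hm]
    field_simp
    ring
  have hD := dirichlet_wirtinger hab hc hcπ hG hgc hGa hGb
  have hparts : ∫ x in a..b, G x * q x = -∫ x in a..b, g x ^ 2 := by
    rw [intervalIntegral.integral_mul_deriv_eq_deriv_mul (fun x _ => hG x) (fun x _ => hg x)
      (hInt hgc) (hInt hq), hGa, hGb]
    simp [sq]
  have hnn : 0 ≤ ∫ x in a..b, (q x + c ^ 2 * G x) ^ 2 :=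
    intervalIntegral.integral_nonneg hab.le fun x _ => sq_nonneg _
  have hE : ∫ x in a..b, (q x + c ^ 2 * G x) ^ 2 =
      (∫ x in a..b, q x ^ 2) + 2 * c ^ 2 * (∫ x in a..b, G x * q x)
      + c ^ 4 * ∫ x in a..b, G x ^ 2 := by
    rw [← intervalIntegral.integral_const_mul, ← intervalIntegral.integral_const_mul,
      ← intervalIntegral.integral_add
      (hInt (by fun_prop)) (hInt (by fun_prop)), ← intervalIntegral.integral_add
      (hInt (by fun_prop)) (hInt (by fun_prop))]
    exact intervalIntegral.integral_congr fun x _ => by ring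
  have := mul_le_mul_of_nonneg_left hD (sq_nonneg c)
  rw [hE, hparts] at hnn
  linarith

lemma hasDerivAt_integral_of_continuous {a b : ℝ} {P P' : ℝ × ℝ → ℝ}
    (hP : Continuous P) (hP' : Continuous P')
    (hd : ∀ x y, HasDerivAt (fun y => P (x, y)) (P' (x, y)) y) (y : ℝ) :
    HasDerivAt (fun y => ∫ x in a..b, P (x, y)) (∫ x in a..b, P' (x, y)) y := by
  obtain ⟨C, hC⟩ := (isCompact_uIcc (a := a) (b := b)).prod (isCompact_closedBall y 1)
    |>.exists_bound_of_continuousOn hP'.continuousOn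
  refine (intervalIntegral.hasDerivAt_integral_of_dominated_loc_of_deriv_le
    (F := fun y x => P (x, y)) (F' := fun y x => P' (x, y)) (bound := fun _ => C)
    (closedBall_mem_nhds y one_pos) (Eventually.of_forall fun y => ?_) ?_ ?_ ?_ ?_ ?_).2
  · exact Continuous.aestronglyMeasurable (by fun_prop)
  · exact Continuous.intervalIntegrable (by fun_prop) _ _
  · exact Continuous.aestronglyMeasurable (by fun_prop)
  · exact Eventually.of_forall fun x hx y' hy' => hC _ ⟨uIoc_subset_uIcc hx, hy'⟩
  · exact intervalIntegrable_const
  · exact Eventually.of_forall fun x _ y' _ => hd x y'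

lemma slice_energy_ge {a b c τ : ℝ} (hab : a < b) (hc : 0 < c) (hcπ : c * (b - a) < Real.pi)
    {p q r : ℝ → ℝ} (hp : ∀ x, HasDerivAt p (q x) x) (hq : Continuous q) (hr : Continuous r) :
    (c ^ 2 - τ ^ 2) * ((∫ x in a..b, p x ^ 2) - (∫ x in a..b, p x) ^ 2 / (b - a))
      + τ * ((∫ x in a..b, 2 * p x * r x)
        - 2 * (∫ x in a..b, p x) * (∫ x in a..b, r x) / (b - a)) ≤
      ∫ x in a..b, (q x ^ 2 + r x ^ 2) := by
  have hpc : Continuous p := continuous_iff_continuousAt.2 fun x => (hp x).continuousAt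
  have hInt : ∀ {u : ℝ → ℝ}, Continuous u → IntervalIntegrable u volume a b :=
    fun hu => hu.intervalIntegrable a b
  have hW := neumann_wirtinger hab hc hcπ hp hq
  rw [intervalIntegral.integral_add (hInt (by fun_prop)) (hInt (by fun_prop))]
  have hM := integral_sub_mean_sq hab hpc
  set V := (∫ x in a..b, p x ^ 2) - (∫ x in a..b, p x) ^ 2 / (b - a)
  set m := (∫ x in a..b, p x) / (b - a) with hm
  have hnn : 0 ≤ ∫ x in a..b, (r x - τ * (p x - m)) ^ 2 :=
    intervalIntegral.integral_nonneg hab.le fun x _ => sq_nonneg _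
  have hE : ∫ x in a..b, (r x - τ * (p x - m)) ^ 2 =
      (∫ x in a..b, r x ^ 2) - τ * (∫ x in a..b, 2 * p x * r x)
        + 2 * τ * m * (∫ x in a..b, r x) + τ ^ 2 * ∫ x in a..b, (p x - m) ^ 2 := by
    simp only [← intervalIntegral.integral_const_mul]
    rw [← intervalIntegral.integral_sub (hInt (by fun_prop)) (hInt (by fun_prop)),
      ← intervalIntegral.integral_add (hInt (by fun_prop)) (hInt (by fun_prop)),
      ← intervalIntegral.integral_add (hInt (by fun_prop)) (hInt (by fun_prop))]
    exact intervalIntegral.integral_congr fun x _ => by ring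
  have hk : 2 * (∫ x in a..b, p x) * (∫ x in a..b, r x) / (b - a) =
      2 * m * ∫ x in a..b, r x := by rw [hm]; ring
  rw [hE, hM] at hnn
  rw [hk]
  linarith

lemma rectangle_trace_inequality {a b c d : ℝ} (hab : a < b) (hc : 0 < c)
    (hcπ : c * (b - a) < Real.pi) (hd : 0 < d) (hcd : 1 / d ≤ c) {F Fx Fy : ℝ × ℝ → ℝ}
    (hF : Continuous F) (hFx : Continuous Fx) (hFy : Continuous Fy)
    (hdx : ∀ x y, HasDerivAt (fun x => F (x, y)) (Fx (x, y)) x)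
    (hdy : ∀ x y, HasDerivAt (fun y => F (x, y)) (Fy (x, y)) y)
    (hmean : ∫ x in a..b, F (x, 0) = 0) :
    (c - 1 / d) * ∫ x in a..b, F (x, 0) ^ 2 ≤
      ∫ y in (-d)..0, ∫ x in a..b, (Fx (x, y) ^ 2 + Fy (x, y) ^ 2) := by
  set V : ℝ → ℝ := fun y =>
    (∫ x in a..b, F (x, y) ^ 2) - (∫ x in a..b, F (x, y)) ^ 2 / (b - a) with hVdef
  set V' : ℝ → ℝ := fun y => (∫ x in a..b, 2 * F (x, y) * Fy (x, y))
    - 2 * (∫ x in a..b, F (x, y)) * (∫ x in a..b, Fy (x, y)) / (b - a) with hV'def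
  set τ : ℝ → ℝ := fun y => (c - 1 / d) * (1 + y / d) with hτdef
  have hVd : ∀ y, HasDerivAt V (V' y) y := by
    intro y
    have h1 := hasDerivAt_integral_of_continuous (a := a) (b := b) (P := fun p => F p ^ 2)
      (P' := fun p => 2 * F p * Fy p) (by fun_prop) (by fun_prop)
      (fun x y => ((hdy x y).pow 2).congr_deriv (by simp)) y
    have h2 := hasDerivAt_integral_of_continuous (a := a) (b := b) hF hFy hdy y
    exact (h1.sub ((h2.pow 2).div_const (b - a))).congr_deriv (by simp [hV'def])
  have hτd : ∀ y, HasDerivAt τ ((c - 1 / d) / d) y := by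
    intro y
    refine ((((hasDerivAt_id y).div_const d).const_add 1).const_mul (c - 1 / d)).congr_deriv ?_
    ring
  have hVnn : ∀ y, 0 ≤ V y := by
    intro y
    simp only [hVdef]
    rw [← integral_sub_mean_sq hab (by fun_prop)]
    exact intervalIntegral.integral_nonneg hab.le fun x _ => sq_nonneg _
  have hpar : ∀ {P : ℝ × ℝ → ℝ}, Continuous P → Continuous fun y => ∫ x in a..b, P (x, y) :=
    fun hP => intervalIntegral.continuous_parametric_intervalIntegral_of_continuous'
      (f := fun y x => _) (by fun_prop) a b
  have hVc : Continuous V := continuous_iff_continuousAt.2 fun y => (hVd y).continuousAt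
  have hV'c : Continuous V' := by
    have h1 := hpar (P := fun p => 2 * F p * Fy p) (by fun_prop)
    have h2 := hpar hF
    have h3 := hpar hFy
    fun_prop
  have hτc : Continuous τ := by fun_prop
  have hEc := hpar (P := fun p => Fx p ^ 2 + Fy p ^ 2) (by fun_prop)
  have hFTC : ∫ y in (-d)..0, ((c - 1 / d) / d * V y + τ y * V' y) =
      (c - 1 / d) * ∫ x in a..b, F (x, 0) ^ 2 := by
    rw [intervalIntegral.integral_eq_sub_of_hasDerivAt (f := fun y => τ y * V y)
      (fun y _ => (hτd y).mul (hVd y)) (Continuous.intervalIntegrable (by fun_prop) _ _)]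
    simp [hτdef, hVdef, hmean, hd.ne']
  rw [← hFTC]
  refine intervalIntegral.integral_mono_on (by linarith)
    (Continuous.intervalIntegrable (by fun_prop) _ _) (hEc.intervalIntegrable _ _) fun y hy => ?_
  have hs := slice_energy_ge (τ := τ y) hab hc hcπ (p := fun x => F (x, y))
    (q := fun x => Fx (x, y)) (r := fun x => Fy (x, y)) (fun x => hdx x y)
    (by fun_prop) (by fun_prop)
  refine le_trans ?_ hs
  have ht0 : 0 ≤ 1 + y / d := by
    have : -1 ≤ y / d := by rw [le_div_iff₀ hd]; linarith [hy.1]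
    linarith
  have ht1 : 1 + y / d ≤ 1 := by linarith [div_nonpos_of_nonpos_of_nonneg hy.2 hd.le]
  have hc0 : 0 ≤ c - 1 / d := sub_nonneg.2 hcd
  have hτ0 : 0 ≤ τ y := mul_nonneg hc0 ht0
  have hτ1 : τ y ≤ c - 1 / d := mul_le_of_le_one_right hc0 ht1
  have hd1 : 0 < 1 / d := by positivity
  have hric : (c - 1 / d) / d + τ y ^ 2 ≤ c ^ 2 := by
    have : (c - 1 / d) / d = (c - 1 / d) * (1 / d) := by ring
    nlinarith
  have := mul_le_mul_of_nonneg_right hric (hVnn y)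
  change _ ≤ (c ^ 2 - τ y ^ 2) * V y + τ y * V' y
  linarith

/-- The open rectangle `(a, b) × (-d, 0)`. -/
def lowerRectangle (a b d : ℝ) : Set E2 := {x : E2 | a < x 0 ∧ x 0 < b ∧ -d < x 1 ∧ x 1 < 0}

lemma lowerRectangle_subset_halfPlane (a b d : ℝ) : lowerRectangle a b d ⊆ {p : E2 | p 1 < 0} :=
  fun _ hp => hp.2.2.2

lemma isOpen_lowerRectangle (a b d : ℝ) : IsOpen (lowerRectangle a b d) := by
  have h (i : Fin 2) : Continuous fun x : E2 => x i := by fun_prop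
  exact (isOpen_lt continuous_const (h 0)).inter ((isOpen_lt (h 0) continuous_const).inter
    ((isOpen_lt continuous_const (h 1)).inter (isOpen_lt (h 1) continuous_const)))

lemma planePoint_preimage_lowerRectangle (a b d : ℝ) :
    {p : ℝ × ℝ | planePoint p.1 p.2 ∈ lowerRectangle a b d} = Ioo a b ×ˢ Ioo (-d) 0 := by
  ext p
  simp [lowerRectangle, and_assoc]

lemma lowerRectangle_eq_image (a b d : ℝ) :
    lowerRectangle a b d =
      (fun p : ℝ × ℝ => planePoint p.1 p.2) '' (Ioo a b ×ˢ Ioo (-d) 0) := by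
  rw [← planePoint_preimage_lowerRectangle]
  exact (image_preimage_eq _ fun p => ⟨(p 0, p 1), planePoint_coords p⟩).symm

lemma isPreconnected_lowerRectangle (a b d : ℝ) : IsPreconnected (lowerRectangle a b d) := by
  rw [lowerRectangle_eq_image]
  exact (isPreconnected_Ioo.prod isPreconnected_Ioo).image _
    (contDiff_planePoint (n := 0)).continuous.continuousOn

lemma horizontalSegment_subset_closure_lowerRectangle {a b d : ℝ} (hab : a < b) (hd : 0 < d) :
    horizontalSegment a b ⊆ closure (lowerRectangle a b d) := by
  rw [lowerRectangle_eq_image]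
  refine Subset.trans ?_ (image_closure_subset_closure_image
    (contDiff_planePoint (n := 0)).continuous)
  rw [closure_prod_eq, closure_Ioo hab.ne, closure_Ioo (by linarith)]
  rintro p ⟨h1, h2, h3⟩
  exact ⟨(p 0, p 1), ⟨⟨h2, h3⟩, ⟨by simp [h1, hd.le], h1.le⟩⟩, planePoint_coords p⟩

lemma lintegral_exp_lowerRectangle_le (a b d : ℝ) {c : ℝ} (hc : 0 < c) :
    ∫⁻ p in lowerRectangle a b d, ENNReal.ofReal (Real.exp (c * p 1)) ≤
      ENNReal.ofReal ((b - a) / c) := by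
  have hle : ∫⁻ p in lowerRectangle a b d, ENNReal.ofReal (Real.exp (c * p 1)) ≤
      ∫⁻ p in {p : E2 | p 1 < 0},
        ENNReal.ofReal (Real.exp (c * p 1)) * (Ioo a b).indicator 1 (p 0) := by
    refine le_trans (le_of_eq ?_) (lintegral_mono_set (lowerRectangle_subset_halfPlane a b d))
    refine setLIntegral_congr_fun (isOpen_lowerRectangle a b d).measurableSet fun p hp => ?_
    simp [indicator_of_mem (show p 0 ∈ Ioo a b from ⟨hp.1, hp.2.1⟩)]
  refine hle.trans (le_of_eq ?_)
  rw [lintegral_exp_mul_halfPlane hc (measurable_one.indicator measurableSet_Ioo),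
    lintegral_indicator_one measurableSet_Ioo, Real.volume_Ioo,
    ← ENNReal.ofReal_mul (by positivity)]
  congr 1
  ring

lemma dirEnergy_lowerRectangle {a b d : ℝ} (hab : a < b) (hd : 0 < d) {f : E2 → ℝ}
    (hf : ContDiff ℝ (⊤ : ℕ∞) f) :
    dirEnergy (lowerRectangle a b d) f = ENNReal.ofReal (∫ y in (-d)..0, ∫ x in a..b,
      (fderiv ℝ f (planePoint x y) (planePoint 1 0) ^ 2 +
        fderiv ℝ f (planePoint x y) (planePoint 0 1) ^ 2)) := by
  have hpp : Continuous fun p : ℝ × ℝ => planePoint p.1 p.2 :=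
    (contDiff_planePoint (n := 0)).continuous
  have hf' : Continuous (fderiv ℝ f) := hf.continuous_fderiv (by simp)
  have hc : Continuous fun p : ℝ × ℝ =>
      fderiv ℝ f (planePoint p.1 p.2) (planePoint 1 0) ^ 2 +
        fderiv ℝ f (planePoint p.1 p.2) (planePoint 0 1) ^ 2 := by
    have := hf'.comp hpp
    simp only [Function.comp_def] at this
    fun_prop
  have hInt : IntegrableOn (fun p : ℝ × ℝ =>
      fderiv ℝ f (planePoint p.1 p.2) (planePoint 1 0) ^ 2 +
        fderiv ℝ f (planePoint p.1 p.2) (planePoint 0 1) ^ 2) (Ioo a b ×ˢ Ioo (-d) 0) :=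
    (hc.continuousOn.integrableOn_compact (isCompact_Icc.prod isCompact_Icc)).mono_set
      (prod_mono Ioo_subset_Icc_self Ioo_subset_Icc_self)
  rw [dirEnergy, setLIntegral_plane, planePoint_preimage_lowerRectangle]
  simp only [nnnorm_sq_dual_plane]
  rw [← ofReal_integral_eq_lintegral_ofReal hInt (Eventually.of_forall fun p => by positivity)]
  congr 1
  rw [IntegrableOn, Measure.volume_eq_prod, ← Measure.prod_restrict] at hInt
  rw [Measure.volume_eq_prod, ← Measure.prod_restrict, integral_prod_symm _ hInt, intervalIntegral.integral_of_le (by linarith),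
    integral_Ioc_eq_integral_Ioo]
  simp only [intervalIntegral.integral_of_le hab.le, integral_Ioc_eq_integral_Ioo]

lemma mul_bdryInt_le_dirEnergy_lowerRectangle {a b c d : ℝ} (hab : a < b) (hc : 0 < c)
    (hcπ : c * (b - a) < Real.pi) (hd : 0 < d) (hcd : 1 / d ≤ c) {f : E2 → ℝ}
    (hf : ContDiff ℝ (⊤ : ℕ∞) f) (hmean : ∫ x in a..b, f (planePoint x 0) = 0) :
    ENNReal.ofReal (c - 1 / d) * bdryInt (horizontalSegment a b) (fun _ => 1) f ≤
      dirEnergy (lowerRectangle a b d) f := by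
  have hpp : Continuous fun p : ℝ × ℝ => planePoint p.1 p.2 :=
    (contDiff_planePoint (n := 0)).continuous
  have hf' : Continuous fun p : ℝ × ℝ => fderiv ℝ f (planePoint p.1 p.2) :=
    (hf.continuous_fderiv (by simp)).comp hpp
  have hd' (x y : ℝ) := (hf.differentiable (by simp) (planePoint x y)).hasFDerivAt
  have hx (x y : ℝ) : HasDerivAt (fun x => planePoint x y) (planePoint 1 0) x := by
    have h : (fun x => planePoint x y) = fun x => x • planePoint 1 0 + planePoint 0 y := by
      funext x
      ext i
      fin_cases i <;> simp [planePoint]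
    rw [h]
    simpa using ((hasDerivAt_id x).smul_const (planePoint 1 0)).add_const (planePoint 0 y)
  have hy (x y : ℝ) : HasDerivAt (fun y => planePoint x y) (planePoint 0 1) y := by
    have h : (fun y => planePoint x y) = fun y => y • planePoint 0 1 + planePoint x 0 := by
      funext y
      ext i
      fin_cases i <;> simp [planePoint]
    rw [h]
    simpa using ((hasDerivAt_id y).smul_const (planePoint 0 1)).add_const (planePoint x 0)
  rw [bdryInt_horizontalSegment hab.le hf.continuous, dirEnergy_lowerRectangle hab hd hf,
    ← ENNReal.ofReal_mul (sub_nonneg.2 hcd)]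
  refine ENNReal.ofReal_le_ofReal ?_
  exact rectangle_trace_inequality hab hc hcπ hd hcd
    (F := fun p => f (planePoint p.1 p.2))
    (Fx := fun p => fderiv ℝ f (planePoint p.1 p.2) (planePoint 1 0))
    (Fy := fun p => fderiv ℝ f (planePoint p.1 p.2) (planePoint 0 1))
    (hf.continuous.comp hpp) (by fun_prop) (by fun_prop)
    (fun x y => (hd' x y).comp_hasDerivAt x (hx x y))
    (fun x y => (hd' x y).comp_hasDerivAt y (hy x y)) hmean

lemma eqOn_zero_of_dirEnergy_lowerRectangle_eq_zero {a b d : ℝ} (hab : a < b) (hd : 0 < d)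
    {f : E2 → ℝ} (hf : ContDiff ℝ (⊤ : ℕ∞) f) (hmean : ∫ x in a..b, f (planePoint x 0) = 0)
    (hE : dirEnergy (lowerRectangle a b d) f = 0) :
    EqOn f 0 (closure (lowerRectangle a b d)) := by
  have hf' : Continuous (fderiv ℝ f) := hf.continuous_fderiv (by simp)
  have hzero : EqOn (fderiv ℝ f) 0 (lowerRectangle a b d) := by
    refine Measure.eqOn_open_of_ae_eq (μ := volume) ?_ (isOpen_lowerRectangle a b d)
      hf'.continuousOn continuousOn_const
    rw [dirEnergy, lintegral_eq_zero_iff (by fun_prop)] at hE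
    filter_upwards [hE] with p hp
    simpa using hp
  obtain ⟨C, hC⟩ := (isOpen_lowerRectangle a b d).exists_is_const_of_fderiv_eq_zero
    (isPreconnected_lowerRectangle a b d) (hf.differentiable (by simp)).differentiableOn hzero
  have hC' : EqOn f (fun _ => C) (closure (lowerRectangle a b d)) :=
    EqOn.closure (fun p hp => hC p hp) hf.continuous continuous_const
  have hI : ∫ x in a..b, f (planePoint x 0) = ∫ _ in a..b, C :=
    intervalIntegral.integral_congr fun x hx => by
      rw [uIcc_of_le hab.le] at hx
      exact hC' (horizontalSegment_subset_closure_lowerRectangle hab hd ⟨rfl, hx.1, hx.2⟩)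
  rw [hI, intervalIntegral.integral_const, smul_eq_mul] at hmean
  have hC0 : C = 0 := (mul_eq_zero.1 hmean).resolve_left (sub_pos.2 hab).ne'
  intro p hp
  rw [hC' hp, hC0]
  rfl

lemma le_steklovN_one_lowerRectangle {a b c d : ℝ} (hab : a < b) (hc : 0 < c)
    (hcπ : c * (b - a) < Real.pi) (hd : 0 < d) (hcd : 1 / d ≤ c) :
    ENNReal.ofReal (c - 1 / d) ≤
      steklovN (lowerRectangle a b d) (horizontalSegment a b) 1 := by
  refine le_iInf fun V => le_iInf fun hV => le_iInf fun hs => le_iInf fun _ => le_iInf fun hnz => ?_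
  have hInt (f : V) : IntervalIntegrable (fun x => (f : E2 → ℝ) (planePoint x 0)) volume a b :=
    ((hs f f.2).continuous.comp isometry_planePoint_zero.continuous).intervalIntegrable a b
  let mean : V →ₗ[ℝ] ℝ :=
    { toFun := fun f => ∫ x in a..b, (f : E2 → ℝ) (planePoint x 0)
      map_add' := fun f g => intervalIntegral.integral_add (hInt f) (hInt g)
      map_smul' := fun r f => intervalIntegral.integral_const_mul r _ }
  have : Module.Finite ℝ V := Module.finite_of_finrank_pos (by rw [hV]; norm_num)
  have hker : LinearMap.ker mean ≠ ⊥ := mean.ker_ne_bot_of_finrank_lt (by simp [hV])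
  obtain ⟨⟨f, hfV⟩, hfker, hf0⟩ := (Submodule.ne_bot_iff _).1 hker
  have hmean : ∫ x in a..b, f (planePoint x 0) = 0 := hfker
  have hfn : ¬ EqOn f 0 (closure (lowerRectangle a b d)) := fun h =>
    hf0 (Subtype.ext (hnz f hfV h))
  refine le_iSup_of_le f <| le_iSup_of_le hfV <| le_iSup_of_le hfn ?_
  rw [rayleigh, ENNReal.le_div_iff_mul_le]
  · exact mul_bdryInt_le_dirEnergy_lowerRectangle hab hc hcπ hd hcd (hs f hfV) hmean
  · exact Or.inr fun h => hfn
      (eqOn_zero_of_dirEnergy_lowerRectangle_eq_zero hab hd (hs f hfV) hmean h)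
  · rw [bdryInt_horizontalSegment hab.le (hs f hfV).continuous]
    exact Or.inl ENNReal.ofReal_ne_top

lemma tendsto_steklovN_one_lowerRectangle {a b : ℝ} (hab : a < b) :
    Tendsto (fun n : ℕ =>
      steklovN (lowerRectangle a b n) (horizontalSegment a b) 1 * ENNReal.ofReal (b - a))
      atTop (𝓝 (ENNReal.ofReal Real.pi)) := by
  have hl : 0 < b - a := sub_pos.2 hab
  have hlim : Tendsto (fun n : ℕ => ENNReal.ofReal (Real.pi - 2 * (b - a) * (1 / (n : ℝ))))
      atTop (𝓝 (ENNReal.ofReal Real.pi)) := by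
    refine ENNReal.tendsto_ofReal ?_
    simpa using (tendsto_one_div_atTop_nhds_zero_nat (𝕜 := ℝ)).const_mul (2 * (b - a))
      |>.const_sub Real.pi
  refine tendsto_of_tendsto_of_tendsto_of_le_of_le' hlim tendsto_const_nhds ?_ ?_
  · filter_upwards [eventually_ge_atTop 1] with n hn
    have hn' : (0 : ℝ) < n := by exact_mod_cast hn
    have hn1 : 0 < 1 / (n : ℝ) := by positivity
    rcases le_or_gt (Real.pi - 2 * (b - a) * (1 / (n : ℝ))) 0 with h | h
    · rw [ENNReal.ofReal_of_nonpos h]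
      exact zero_le
    · have hgt : 2 * (1 / (n : ℝ)) < Real.pi / (b - a) := by
        rw [lt_div_iff₀ hl]; linarith
      have hlow := le_steklovN_one_lowerRectangle (c := Real.pi / (b - a) - 1 / n) (d := n) hab
        (by linarith) (by rw [sub_mul, div_mul_cancel₀ _ hl.ne']; nlinarith) hn' (by linarith)
      calc _ = ENNReal.ofReal (Real.pi / (b - a) - 1 / n - 1 / n) * ENNReal.ofReal (b - a) := by
            rw [← ENNReal.ofReal_mul (by linarith)]
            congr 1
            field_simp
            ring
        _ ≤ _ := by gcongr
  · filter_upwards [eventually_ge_atTop 1] with n hn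
    have hn' : (0 : ℝ) < n := by exact_mod_cast hn
    have hup := steklovN_one_le hab (horizontalSegment_subset_closure_lowerRectangle hab hn')
      fun c hc => lintegral_exp_lowerRectangle_le a b n hc
    calc _ ≤ ENNReal.ofReal (Real.pi / (b - a)) * ENNReal.ofReal (b - a) := by gcongr
      _ = _ := by
        rw [← ENNReal.ofReal_mul (by positivity), div_mul_cancel₀ _ hl.ne']

lemma lintegral_exp_le_of_integral_le {Ω : Set E2} (hb : Bornology.IsBounded Ω) {c M : ℝ}
    (h : ∫ x in Ω, Real.exp (c * x 1) ≤ M) :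
    ∫⁻ p in Ω, ENNReal.ofReal (Real.exp (c * p 1)) ≤ ENNReal.ofReal M := by
  have hc : Continuous fun p : E2 => Real.exp (c * p 1) := by fun_prop
  rw [← ofReal_integral_eq_lintegral_ofReal
    ((hc.continuousOn.integrableOn_compact hb.isCompact_closure).mono_set subset_closure)
    (Eventually.of_forall fun p => (Real.exp_pos _).le)]
  exact ENNReal.ofReal_le_ofReal h

lemma steklovN_mul_lt {Ω : Set E2} {a b : ℝ} (hab : a < b)
    (hcl : horizontalSegment a b ⊆ closure Ω) (hlow : Ω ⊆ {p : E2 | p 1 < 0})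
    (hJohn : ∀ c : ℝ, 0 < c →
      ∫⁻ p in Ω, ENNReal.ofReal (Real.exp (c * p 1)) ≤ ENNReal.ofReal ((b - a) / c))
    {k : ℕ} (hk : 2 ≤ k) :
    steklovN Ω (horizontalSegment a b) k * ENNReal.ofReal (b - a) <
      ENNReal.ofReal ((2 * (k : ℝ) - 1) * Real.pi) := by
  have hl : 0 < b - a := sub_pos.2 hab
  obtain ⟨M, hM0, hM, hle⟩ : ∃ M : ℝ, 0 ≤ M ∧ M < (2 * (k : ℝ) - 1) * Real.pi ∧
      steklovN Ω (horizontalSegment a b) k ≤ ENNReal.ofReal (M / (b - a)) := by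
    rcases hk.eq_or_lt with rfl | hk
    · refine ⟨2 * Real.pi, by positivity, ?_, steklovN_two_le hab hcl hJohn⟩
      push_cast
      linarith [Real.pi_pos]
    · refine ⟨10 / 3 * (k + 1), by positivity, ?_, steklovN_le_of_subset_halfPlane hab hcl hlow k⟩
      have hk3 : (3 : ℝ) ≤ k := by exact_mod_cast hk
      nlinarith [Real.pi_gt_three]
  calc _ ≤ ENNReal.ofReal (M / (b - a)) * ENNReal.ofReal (b - a) := by gcongr
    _ = ENNReal.ofReal M := by
        rw [← ENNReal.ofReal_mul (by positivity), div_mul_cancel₀ _ hl.ne']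
    _ < _ := (ENNReal.ofReal_lt_ofReal_iff_of_nonneg hM0).2 hM

theorem statement4 (Ω : Set E2) (a b : ℝ) (hab : a < b)
    (hΩ : IsLipschitzDomain Ω)
    (hI : frontier Ω ∩ {x : E2 | x 1 = 0} = {x : E2 | x 1 = 0 ∧ a ≤ x 0 ∧ x 0 ≤ b})
    (hlow : Ω ⊆ {x : E2 | x 1 < 0})
    (hJohn : ∀ c : ℝ, 0 < c → (∫ x in Ω, Real.exp (c * x 1)) ≤ (b - a) / c) :
    (∀ k : ℕ, 1 ≤ k →
      steklovN Ω {x : E2 | x 1 = 0 ∧ a ≤ x 0 ∧ x 0 ≤ b} k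
          * μH[1] {x : E2 | x 1 = 0 ∧ a ≤ x 0 ∧ x 0 ≤ b}
        ≤ ENNReal.ofReal ((2 * (k : ℝ) - 1) * Real.pi))
    ∧ Tendsto (fun n : ℕ =>
        steklovN {x : E2 | a < x 0 ∧ x 0 < b ∧ -(n : ℝ) < x 1 ∧ x 1 < 0}
            {x : E2 | x 1 = 0 ∧ a ≤ x 0 ∧ x 0 ≤ b} 1 * ENNReal.ofReal (b - a))
        atTop (𝓝 (ENNReal.ofReal Real.pi))
    ∧ (∀ k : ℕ, 2 ≤ k →
        (∀ c : ℝ, 0 < c → (∫ x in Ω, Real.exp (c * x 1)) < (b - a) / c) →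
        steklovN Ω {x : E2 | x 1 = 0 ∧ a ≤ x 0 ∧ x 0 ≤ b} k
            * μH[1] {x : E2 | x 1 = 0 ∧ a ≤ x 0 ∧ x 0 ≤ b}
          < ENNReal.ofReal ((2 * (k : ℝ) - 1) * Real.pi)) := by
  have hcl : horizontalSegment a b ⊆ closure Ω := by
    rw [horizontalSegment, ← hI]
    exact inter_subset_left.trans frontier_subset_closure
  have hJ : ∀ c : ℝ, 0 < c →
      ∫⁻ p in Ω, ENNReal.ofReal (Real.exp (c * p 1)) ≤ ENNReal.ofReal ((b - a) / c) :=
    fun c hc => lintegral_exp_le_of_integral_le hΩ.2.2.1 (hJohn c hc)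
  have hlt {k : ℕ} (hk : 2 ≤ k) : steklovN Ω (horizontalSegment a b) k
      * μH[1] (horizontalSegment a b) < ENNReal.ofReal ((2 * (k : ℝ) - 1) * Real.pi) := by
    rw [hausdorffMeasure_horizontalSegment]
    exact steklovN_mul_lt hab hcl hlow hJ hk
  refine ⟨fun k hk => ?_, tendsto_steklovN_one_lowerRectangle hab, fun k hk _ => hlt hk⟩
  rcases hk.eq_or_lt with rfl | hk
  · change steklovN Ω (horizontalSegment a b) 1 * μH[1] (horizontalSegment a b) ≤ _
    rw [hausdorffMeasure_horizontalSegment]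
    have hl : 0 < b - a := sub_pos.2 hab
    calc _ ≤ ENNReal.ofReal (Real.pi / (b - a)) * ENNReal.ofReal (b - a) := by
          gcongr
          exact steklovN_one_le hab hcl hJ
      _ = _ := by
          rw [← ENNReal.ofReal_mul (by positivity), div_mul_cancel₀ _ hl.ne']
          norm_num
  · exact (hlt hk).le

end
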